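/- Let $m,n$ be positive integers with $m \ge 9$, $n > m+1+\max\{3, 11/(m-8)\}$, and $(m-1) \nmid (n-5)$. Then $r(T_m', T_n'') = m+n-6$, where $T_m'$ is the unique tree on $m$ vertices with maximum degree $m-2$ and $T_n''$ is the tree defined below. -/

import Mathlib

open SimpleGraph

/-- `Contains G H` : the graph `G` contains a copy of `H` as a subgraph. -/
def Contains {V W : Type*} (G : SimpleGraph V) (H : SimpleGraph W) : Prop :=
  ∃ f : W ↪ V, ∀ a b, H.Adj a b → G.Adj (f a) (f b)

/-- The Ramsey number `r(G₁,G₂)`: the smallest positive `p` such that every graph on `p`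
vertices contains a copy of `G₁` or its complement contains a copy of `G₂`. -/
noncomputable def ramseyNumber {α β : Type*} (G₁ : SimpleGraph α) (G₂ : SimpleGraph β) : ℕ :=
  sInf {p | 0 < p ∧ ∀ G : SimpleGraph (Fin p), Contains G G₁ ∨ Contains Gᶜ G₂}

/-- The Turán/extremal number `ex(p; L)`: maximal number of edges of a graph on `p`
vertices with no copy of `L`. -/
noncomputable def exNum {W : Type*} (p : ℕ) (L : SimpleGraph W) : ℕ :=
  sSup {m | ∃ G : SimpleGraph (Fin p), ¬ Contains G L ∧ G.edgeSet.ncard = m}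

/-- The maximum degree of a graph. -/
noncomputable def maxDeg {α : Type*} (G : SimpleGraph α) : ℕ :=
  sSup {d | ∃ v, d = (G.neighborSet v).ncard}

/-- The star `K_{1,m-1}` on `m` vertices, centered at `0`. -/
def starGraph (m : ℕ) : SimpleGraph (Fin m) :=
  SimpleGraph.fromRel (fun i _ => (i : ℕ) = 0)

/-- The double star `S(n₁,n₂)`: vertex `0` is adjacent to `1` and to the `n₁` vertices
`2,…,n₁+1`; vertex `1` is adjacent to the `n₂` vertices `n₁+2,…,n₁+n₂+1`. -/
def doubleStar (n₁ n₂ : ℕ) : SimpleGraph (Fin (n₁ + n₂ + 2)) :=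
  SimpleGraph.fromRel (fun i j =>
    ((i : ℕ) = 0 ∧ (j : ℕ) = 1) ∨
    ((i : ℕ) = 0 ∧ 2 ≤ (j : ℕ) ∧ (j : ℕ) ≤ n₁ + 1) ∨
    ((i : ℕ) = 1 ∧ n₁ + 2 ≤ (j : ℕ)))

/-- The tree `Tₙ''` with edges `v₀vᵢ (1 ≤ i ≤ n-4)`, `v₁v_{n-3}`, `v₁v_{n-2}`, `v₂v_{n-1}`. -/
def treeDD (n : ℕ) : SimpleGraph (Fin n) :=
  SimpleGraph.fromRel (fun i j =>
    ((i : ℕ) = 0 ∧ 1 ≤ (j : ℕ) ∧ (j : ℕ) ≤ n - 4) ∨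
    ((i : ℕ) = 1 ∧ ((j : ℕ) = n - 3 ∨ (j : ℕ) = n - 2)) ∨
    ((i : ℕ) = 2 ∧ (j : ℕ) = n - 1))

/-- The tree `Tₙ'''` with edges `v₀vᵢ (1 ≤ i ≤ n-4)`, `v₁v_{n-3}`, `v₂v_{n-2}`, `v₃v_{n-1}`. -/
def treeDDD (n : ℕ) : SimpleGraph (Fin n) :=
  SimpleGraph.fromRel (fun i j =>
    ((i : ℕ) = 0 ∧ 1 ≤ (j : ℕ) ∧ (j : ℕ) ≤ n - 4) ∨
    ((i : ℕ) = 1 ∧ (j : ℕ) = n - 3) ∨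
    ((i : ℕ) = 2 ∧ (j : ℕ) = n - 2) ∨
    ((i : ℕ) = 3 ∧ (j : ℕ) = n - 1))

/-- The tree `Tₙ¹` with edges `v₀vᵢ (1 ≤ i ≤ n-3)`, `v_{n-4}v_{n-2}`, `v_{n-3}v_{n-1}`. -/
def treeT1 (n : ℕ) : SimpleGraph (Fin n) :=
  SimpleGraph.fromRel (fun i j =>
    ((i : ℕ) = 0 ∧ 1 ≤ (j : ℕ) ∧ (j : ℕ) ≤ n - 3) ∨
    ((i : ℕ) = n - 4 ∧ (j : ℕ) = n - 2) ∨
    ((i : ℕ) = n - 3 ∧ (j : ℕ) = n - 1))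

/-- The tree `Tₙ²` with edges `v₀vᵢ (1 ≤ i ≤ n-3)`, `v_{n-3}v_{n-2}`, `v_{n-3}v_{n-1}`. -/
def treeT2 (n : ℕ) : SimpleGraph (Fin n) :=
  SimpleGraph.fromRel (fun i j =>
    ((i : ℕ) = 0 ∧ 1 ≤ (j : ℕ) ∧ (j : ℕ) ≤ n - 3) ∨
    ((i : ℕ) = n - 3 ∧ ((j : ℕ) = n - 2 ∨ (j : ℕ) = n - 1)))

open scoped Classical in
theorem exists_seq {V : Type*} (S : Finset V) (k : ℕ) (hk : k ≤ S.card) (x : V) :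
    ∃ g : ℕ → V, (∀ i, i < k → g i ∈ S) ∧ (∀ i j, i < k → j < k → g i = g j → i = j) := by
  let e := S.equivFin.symm
  refine ⟨fun i => if h : i < S.card then (e ⟨i, h⟩ : V) else x, ?_, ?_⟩
  · intro i hi
    have : i < S.card := by omega
    simp [this]
  · intro i j hi hj h
    have h1 : i < S.card := by omega
    have h2 : j < S.card := by omega
    simp only [h1, h2, dif_pos] at h
    have := e.injective (Subtype.ext h)
    simpa using this

theorem contains_doubleStar {V : Type*} (G : SimpleGraph V) (k : ℕ) (v u w : V) (S : Finset V)
    (huv : G.Adj v u) (huw : G.Adj u w) (hwv : w ≠ v) (hS : k ≤ S.card)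
    (hSa : ∀ x ∈ S, G.Adj v x) (hu : u ∉ S) (hw : w ∉ S) : Contains G (doubleStar k 1) := by
  obtain ⟨g, hg, hgi⟩ := exists_seq S k hS v
  have hv : v ∉ S := fun h => (hSa v h).ne rfl
  have h1 := huv.ne
  have h2 := huw.ne
  let f : ℕ → V := fun i => if i = 0 then v else if i = 1 then u else if i ≤ k + 1 then g (i - 2)
    else w
  have f0 : f 0 = v := by simp [f]
  have f1 : f 1 = u := by simp [f]
  have f2 : ∀ i, 2 ≤ i → i ≤ k + 1 → f i = g (i - 2) := by
    intro i h1 h2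
    simp only [f]
    rw [if_neg (by omega), if_neg (by omega), if_pos h2]
  have f3 : f (k + 2) = w := by
    simp only [f]
    rw [if_neg (by omega), if_neg (by omega), if_neg (by omega)]
  have cases : ∀ i, i < k + 1 + 2 → i = 0 ∨ i = 1 ∨ (2 ≤ i ∧ i ≤ k + 1) ∨ i = k + 2 := by
    intro i hi; omega
  refine ⟨⟨fun i => f i, ?_⟩, ?_⟩
  · intro i j h
    have h : f i = f j := h
    have hi := cases i i.2
    have hj := cases j j.2
    apply Fin.ext
    rcases hi with hi | hi | hi | hi <;> rcases hj with hj | hj | hj | hj <;>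
      first
      | omega
      | (exfalso; grind)
      | skip
    rw [f2 _ hi.1 hi.2, f2 _ hj.1 hj.2] at h
    have := hgi _ _ (by omega) (by omega) h
    omega
  · have key : ∀ i j : ℕ, i < k + 3 → j < k + 3 → ((i : ℕ) = 0 ∧ (j : ℕ) = 1) ∨
        ((i : ℕ) = 0 ∧ 2 ≤ (j : ℕ) ∧ (j : ℕ) ≤ k + 1) ∨
        ((i : ℕ) = 1 ∧ k + 2 ≤ (j : ℕ)) → G.Adj (f i) (f j) := by
      rintro i j hi hj (⟨rfl, rfl⟩ | ⟨rfl, h1, h2⟩ | ⟨rfl, h⟩)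
      · rwa [f0, f1]
      · rw [f0, f2 _ h1 h2]; exact hSa _ (hg _ (by omega))
      · have : j = k + 2 := by omega
        subst this
        rwa [f1, f3]
    intro a b hab
    rw [doubleStar, SimpleGraph.fromRel_adj] at hab
    rcases hab.2 with h | h
    · exact key _ _ a.2 b.2 h
    · exact (key _ _ b.2 a.2 h).symm

theorem contains_treeDD {V : Type*} (G : SimpleGraph V) (n : ℕ) (hn : 6 ≤ n)
    (v v1 v2 a b c : V) (S : Finset V)
    (h1 : G.Adj v v1) (h2 : G.Adj v v2) (ha : G.Adj v1 a) (hb : G.Adj v1 b) (hc : G.Adj v2 c)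
    (hd : [v, v1, v2, a, b, c].Nodup) (hS : n - 6 ≤ S.card)
    (hSa : ∀ x ∈ S, G.Adj v x) (hSn : ∀ x ∈ S, x ∉ [v1, v2, a, b, c]) :
    Contains G (treeDD n) := by
  obtain ⟨g, hg, hgi⟩ := exists_seq S (n - 6) hS v
  have hv : v ∉ S := fun h => (hSa v h).ne rfl
  have hv1 : v1 ∉ S := fun h => hSn _ h (by simp)
  have hv2 : v2 ∉ S := fun h => hSn _ h (by simp)
  have hav : a ∉ S := fun h => hSn _ h (by simp)
  have hbv : b ∉ S := fun h => hSn _ h (by simp)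
  have hcv : c ∉ S := fun h => hSn _ h (by simp)
  simp only [List.nodup_cons, List.mem_cons, List.not_mem_nil, or_false, not_or] at hd
  clear hSn
  let f : ℕ → V := fun i => if i = 0 then v else if i = 1 then v1 else if i = 2 then v2
    else if i = n - 3 then a else if i = n - 2 then b else if i = n - 1 then c else g (i - 3)
  have f0 : f 0 = v := by simp [f]
  have f1 : f 1 = v1 := by simp [f]
  have f2 : f 2 = v2 := by simp [f]
  have fa : f (n - 3) = a := by simp only [f]; grind
  have fb : f (n - 2) = b := by simp only [f]; grind
  have fc : f (n - 1) = c := by simp only [f]; grind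
  have fg : ∀ i, 3 ≤ i → i ≤ n - 4 → f i = g (i - 3) := by
    intro i h1 h2; simp only [f]; grind
  have cases : ∀ i, i < n → i = 0 ∨ i = 1 ∨ i = 2 ∨ i = n - 3 ∨ i = n - 2 ∨ i = n - 1 ∨
      (3 ≤ i ∧ i ≤ n - 4) := by
    intro i hi; omega
  clear_value f
  refine ⟨⟨fun i => f i, ?_⟩, ?_⟩
  · intro i j h
    have h : f i = f j := h
    have hi := cases i i.2
    have hj := cases j j.2
    have hgm : ∀ i, 3 ≤ i → i ≤ n - 4 → f i ∈ S := by
      intro i h1 h2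
      rw [fg _ h1 h2]; exact hg _ (by omega)
    apply Fin.ext
    generalize (i : ℕ) = i at *
    generalize (j : ℕ) = j at *
    by_cases hij : (3 ≤ i ∧ i ≤ n - 4) ∧ (3 ≤ j ∧ j ≤ n - 4)
    · obtain ⟨hi, hj⟩ := hij
      rw [fg _ hi.1 hi.2, fg _ hj.1 hj.2] at h
      have := hgi _ _ (by omega) (by omega) h
      omega
    · clear fg hgi hg
      rcases hi with hi | hi | hi | hi | hi | hi | hi <;>
      rcases hj with hj | hj | hj | hj | hj | hj | hj <;>
      first
      | omega
      | (exfalso; grind)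
  · have key : ∀ i j : ℕ, i < n → j < n → ((i : ℕ) = 0 ∧ 1 ≤ (j : ℕ) ∧ (j : ℕ) ≤ n - 4) ∨
        ((i : ℕ) = 1 ∧ ((j : ℕ) = n - 3 ∨ (j : ℕ) = n - 2)) ∨
        ((i : ℕ) = 2 ∧ (j : ℕ) = n - 1) → i ≠ j → G.Adj (f i) (f j) := by
      rintro i j hi hj (⟨rfl, h3, h4⟩ | ⟨rfl, rfl | rfl⟩ | ⟨rfl, rfl⟩) hne
      · rw [f0]
        rcases (by omega : j = 1 ∨ j = 2 ∨ 3 ≤ j) with rfl | rfl | h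
        · rwa [f1]
        · rwa [f2]
        · rw [fg _ h h4]; exact hSa _ (hg _ (by omega))
      · rwa [f1, fa]
      · rwa [f1, fb]
      · rwa [f2, fc]
    intro x y hab
    rw [treeDD, SimpleGraph.fromRel_adj] at hab
    have hne : (x : ℕ) ≠ y := fun h => hab.1 (Fin.ext h)
    rcases hab.2 with h | h
    · exact key _ _ x.2 y.2 h hne
    · exact (key _ _ y.2 x.2 h hne.symm).symm

section upper
open scoped Classical
variable {V : Type*} [Fintype V]

theorem F1 (G : SimpleGraph V) (m : ℕ) (hm : 9 ≤ m) (hG : ¬ Contains G (doubleStar (m - 3) 1))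
    (v u : V) (hv : m - 1 ≤ G.degree v) (huv : G.Adj v u) : G.degree u ≤ 1 := by
  by_contra hc
  have : ∃ w ∈ G.neighborFinset u, w ≠ v := by
    apply Finset.exists_mem_ne
    rw [G.card_neighborFinset_eq_degree]; omega
  obtain ⟨w, hw, hwv⟩ := this
  rw [G.mem_neighborFinset] at hw
  apply hG
  refine contains_doubleStar G _ v u w (((G.neighborFinset v).erase u).erase w) huv hw hwv ?_ ?_
    (by simp) (by simp)
  · have h1 := Finset.pred_card_le_card_erase (s := G.neighborFinset v) (a := u)
    have h2 := Finset.pred_card_le_card_erase (s := (G.neighborFinset v).erase u) (a := w)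
    rw [G.card_neighborFinset_eq_degree] at h1
    omega
  · intro x hx
    simp at hx
    exact hx.2.2

theorem F2 (G : SimpleGraph V) (m : ℕ) (hm : 9 ≤ m) (hG : ¬ Contains G (doubleStar (m - 3) 1))
    (hV : ¬ (m - 1) ∣ Fintype.card V) (hne : 0 < Fintype.card V) : ∃ v, G.degree v ≤ m - 3 := by
  by_contra! hc
  have hne' : Nonempty V := Fintype.card_pos_iff.1 hne
  have hle : ∀ v, G.degree v = m - 2 := by
    intro v
    by_contra h
    have hv : m - 1 ≤ G.degree v := by have := hc v; omega
    have : 0 < (G.neighborFinset v).card := by rw [G.card_neighborFinset_eq_degree]; omega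
    obtain ⟨u, hu⟩ := Finset.card_pos.1 this
    have := F1 G m hm hG v u hv (by simpa using hu)
    have := hc u
    omega
  let N : V → Finset V := fun v => insert v (G.neighborFinset v)
  have hcard : ∀ v, (N v).card = m - 1 := by
    intro v
    rw [Finset.card_insert_of_notMem (by simp), G.card_neighborFinset_eq_degree, hle]; omega
  have hsub : ∀ v u, u ∈ N v → N u = N v := by
    intro v u hu
    rcases Finset.mem_insert.1 hu with rfl | hu'
    · rfl
    have huv : G.Adj v u := by simpa using hu'
    apply Finset.eq_of_subset_of_card_le _ (by rw [hcard, hcard])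
    intro w hw
    rcases Finset.mem_insert.1 hw with rfl | hw'
    · exact hu
    have huw : G.Adj u w := by simpa using hw'
    by_contra hwn
    simp only [N, Finset.mem_insert, G.mem_neighborFinset, not_or] at hwn
    apply hG
    refine contains_doubleStar G _ v u w ((G.neighborFinset v).erase u) huv huw hwn.1 ?_ ?_
      (by simp) (by simp [hwn.2])
    · have h1 := Finset.pred_card_le_card_erase (s := G.neighborFinset v) (a := u)
      rw [G.card_neighborFinset_eq_degree, hle] at h1
      omega
    · intro x hx
      simp at hx
      exact hx.2
  apply hV
  rw [← Finset.card_univ, Finset.card_eq_sum_card_image N]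
  apply Finset.dvd_sum
  intro b hb
  obtain ⟨v, -, rfl⟩ := Finset.mem_image.1 hb
  have : (Finset.univ.filter fun a => N a = N v) = N v := by
    ext a
    simp only [Finset.mem_filter, Finset.mem_univ, true_and]
    constructor
    · intro h; rw [← h]; simp [N]
    · exact hsub v a
  rw [this, hcard]

theorem upper (G : SimpleGraph V) (m n : ℕ) (hm : 9 ≤ m) (hn : m + 5 ≤ n) (hn' : m = 9 → 15 ≤ n)
    (hG : ¬ Contains G (doubleStar (m - 3) 1)) (hcard : Fintype.card V = m + n - 6)
    (hV : ¬ (m - 1) ∣ (n - 5)) : Contains Gᶜ (treeDD n) := by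
  obtain ⟨v, hv⟩ := F2 G m hm hG (by
    rw [hcard, show m + n - 6 = (m - 1) + (n - 5) by omega]
    simpa using hV) (by omega)
  set d := G.degree v with hd
  set B := G.neighborFinset v with hB
  set A := Gᶜ.neighborFinset v with hA
  have hBc : B.card = d := G.card_neighborFinset_eq_degree v
  have hAc : A.card = m + n - 7 - d := by
    rw [hA, Gᶜ.card_neighborFinset_eq_degree, G.degree_compl, hcard, ← hd]; omega
  have memA : ∀ x, x ∈ A ↔ Gᶜ.Adj v x := by simp [hA]
  have memB : ∀ x, x ∈ B ↔ G.Adj v x := by simp [hB]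
  have hAB : ∀ x ∈ A, x ∉ B := by
    intro x hx; rw [memB]; rw [memA, G.compl_adj] at hx; exact hx.2
  have hvA : v ∉ A := by simp [memA]
  have hvB : v ∉ B := by simp [memB]
  by_cases hsmall : d ≤ m - 6
  · -- everything inside A
    have hAn : n - 1 ≤ A.card := by omega
    have good : ∃ v1 ∈ A, ∃ v2 ∈ A, v1 ≠ v2 ∧ 4 ≤ (A ∩ Gᶜ.neighborFinset v1).card ∧
        4 ≤ (A ∩ Gᶜ.neighborFinset v2).card := by
      have hsplit : ∀ x ∈ A, A.card ≤
          1 + (A ∩ G.neighborFinset x).card + (A ∩ Gᶜ.neighborFinset x).card := by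
        intro x hx
        have : A ⊆ {x} ∪ (A ∩ G.neighborFinset x) ∪ (A ∩ Gᶜ.neighborFinset x) := by
          intro y hy
          simp only [Finset.mem_union, Finset.mem_inter, Finset.mem_singleton,
            SimpleGraph.mem_neighborFinset, SimpleGraph.compl_adj]
          grind
        have h1 := Finset.card_le_card this
        have h2 := Finset.card_union_le ({x} ∪ (A ∩ G.neighborFinset x))
          (A ∩ Gᶜ.neighborFinset x)
        have h3 := Finset.card_union_le {x} (A ∩ G.neighborFinset x)
        simp only [Finset.card_singleton] at h3
        omega
      have hle : ∀ x, (A ∩ G.neighborFinset x).card ≤ G.degree x := by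
        intro x
        rw [← G.card_neighborFinset_eq_degree]
        exact Finset.card_le_card Finset.inter_subset_right
      by_contra! hbad
      have : ∃ x ∈ A, (A ∩ Gᶜ.neighborFinset x).card < 4 := by
        obtain ⟨v1, h1, v2, h2, h12⟩ := Finset.one_lt_card.1 (show 1 < A.card by omega)
        by_cases h : 4 ≤ (A ∩ Gᶜ.neighborFinset v1).card
        · exact ⟨v2, h2, hbad v1 h1 v2 h2 h12 h⟩
        · exact ⟨v1, h1, by omega⟩
      obtain ⟨x, hx, hx4⟩ := this
      have h1 := hsplit x hx
      have h2 := hle x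
      obtain ⟨y, hy, z, hz, hyz⟩ :=
        Finset.one_lt_card.1 (show 1 < (A ∩ G.neighborFinset x).card by omega)
      simp only [Finset.mem_inter, SimpleGraph.mem_neighborFinset] at hy hz
      have hy1 := F1 G m hm hG x y (by omega) hy.2
      have hz1 := F1 G m hm hG x z (by omega) hz.2
      have := hsplit y hy.1
      have := hsplit z hz.1
      have := hle y
      have := hle z
      have := hbad y hy.1 z hz.1 hyz (by omega)
      omega
    obtain ⟨v1, h1, v2, h2, h12, c1, c2⟩ := good
    have : ∃ c ∈ A ∩ Gᶜ.neighborFinset v2, c ≠ v1 :=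
      Finset.exists_mem_ne (by omega) _
    obtain ⟨c, hc, hcv⟩ := this
    have : 1 < (((A ∩ Gᶜ.neighborFinset v1).erase v2).erase c).card := by
      have h1 := Finset.pred_card_le_card_erase (s := A ∩ Gᶜ.neighborFinset v1) (a := v2)
      have h2 := Finset.pred_card_le_card_erase
        (s := (A ∩ Gᶜ.neighborFinset v1).erase v2) (a := c)
      omega
    obtain ⟨a, ha, b, hb, hab⟩ := Finset.one_lt_card.1 this
    simp only [Finset.mem_erase, Finset.mem_inter, SimpleGraph.mem_neighborFinset] at ha hb hc
    have hav := ha.2.2.2.ne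
    have hbv := hb.2.2.2.ne
    have hcv2 := hc.2.ne
    refine contains_treeDD Gᶜ n (by omega) v v1 v2 a b c (A \ {v1, v2, a, b, c})
      ((memA _).1 h1) ((memA _).1 h2) ha.2.2.2 hb.2.2.2 hc.2 ?_ ?_ ?_ ?_
    · simp only [List.nodup_cons, List.mem_cons, List.not_mem_nil, or_false, not_or]
      grind
    · have h3 := Finset.le_card_sdiff {v1, v2, a, b, c} A
      have h4 : ({v1, v2, a, b, c} : Finset V).card ≤ 5 := Finset.card_le_five
      omega
    · intro x hx; exact (memA _).1 (Finset.mem_sdiff.1 hx).1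
    · intro x hx; simpa using (Finset.mem_sdiff.1 hx).2
  · have hdB : ∀ b ∈ B, G.degree b ≤ m - 2 := by
      intro b hb
      by_contra h
      have := F1 G m hm hG b v (by omega) ((memB _).1 hb).symm
      omega
    have hdBA : ∀ b ∈ B, (A ∩ G.neighborFinset b).card ≤ m - 3 := by
      intro b hb
      have h1 : insert v (A ∩ G.neighborFinset b) ⊆ G.neighborFinset b := by
        intro x hx
        rcases Finset.mem_insert.1 hx with rfl | hx
        · simpa using ((memB _).1 hb).symm
        · exact (Finset.mem_inter.1 hx).2
      have h2 := Finset.card_le_card h1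
      rw [Finset.card_insert_of_notMem (by simp [hvA]), G.card_neighborFinset_eq_degree] at h2
      have := hdB b hb
      omega
    have e1 : ∃ v1 ∈ A, 3 ≤ (B ∩ Gᶜ.neighborFinset v1).card := by
      by_contra! hbad
      have hlow : ∀ x ∈ A, d - 2 ≤ (B ∩ G.neighborFinset x).card := by
        intro x hx
        have h1 : B ⊆ (B ∩ G.neighborFinset x) ∪ (B ∩ Gᶜ.neighborFinset x) := by
          intro y hy
          have : x ≠ y := fun h => hAB x hx (h ▸ hy)
          simp only [Finset.mem_union, Finset.mem_inter,
            SimpleGraph.mem_neighborFinset, SimpleGraph.compl_adj]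
          grind
        have h2 := Finset.card_le_card h1
        have h3 := Finset.card_union_le (B ∩ G.neighborFinset x) (B ∩ Gᶜ.neighborFinset x)
        have := hbad x hx
        omega
      have hdc : ∑ x ∈ A, (B ∩ G.neighborFinset x).card
          = ∑ b ∈ B, (A ∩ G.neighborFinset b).card := by
        have h := Finset.sum_card_bipartiteAbove_eq_sum_card_bipartiteBelow
          (s := A) (t := B) (fun x y => G.Adj x y)
        convert h using 2 with x hx x hx
        · congr 1; ext y; simp [Finset.bipartiteAbove]
        · congr 1; ext y; simp [Finset.bipartiteBelow, G.adj_comm]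
      have hL := Finset.card_nsmul_le_sum A _ _ hlow
      have hU := Finset.sum_le_card_nsmul B _ _ hdBA
      rw [hdc] at hL
      have hLU := hL.trans hU
      rw [smul_eq_mul, smul_eq_mul, hAc, hBc] at hLU
      rcases (by omega : d = m - 5 ∨ d = m - 4 ∨ d = m - 3) with h | h | h
      · rw [h, show m + n - 7 - (m - 5) = n - 2 by omega] at hLU
        obtain ⟨k, rfl⟩ := Nat.exists_eq_add_of_le hm
        obtain ⟨l, rfl⟩ := Nat.exists_eq_add_of_le hn
        rw [show 9 + k + 5 + l - 2 = k + l + 12 by omega, show 9 + k - 5 - 2 = k + 2 by omega,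
          show 9 + k - 5 = k + 4 by omega, show 9 + k - 3 = k + 6 by omega] at hLU
        have : 0 < k + l := by
          rcases Nat.eq_zero_or_pos k with h | h
          · have := hn' (by omega); omega
          · omega
        nlinarith [Nat.zero_le (k * l)]
      · rw [h, show m + n - 7 - (m - 4) = n - 3 by omega] at hLU
        obtain ⟨k, rfl⟩ := Nat.exists_eq_add_of_le hm
        obtain ⟨l, rfl⟩ := Nat.exists_eq_add_of_le hn
        rw [show 9 + k + 5 + l - 3 = k + l + 11 by omega, show 9 + k - 4 - 2 = k + 3 by omega,
          show 9 + k - 4 = k + 5 by omega, show 9 + k - 3 = k + 6 by omega] at hLU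
        nlinarith [Nat.zero_le (k * l)]
      · rw [h, show m + n - 7 - (m - 3) = n - 4 by omega] at hLU
        obtain ⟨k, rfl⟩ := Nat.exists_eq_add_of_le hm
        obtain ⟨l, rfl⟩ := Nat.exists_eq_add_of_le hn
        rw [show 9 + k + 5 + l - 4 = k + l + 10 by omega, show 9 + k - 3 - 2 = k + 4 by omega,
          show 9 + k - 3 = k + 6 by omega] at hLU
        nlinarith [Nat.zero_le (k * l)]
    obtain ⟨v1, h1, hv1⟩ := e1
    have e2 : ∃ v2 ∈ A, v2 ≠ v1 ∧ ∃ c ∈ B, Gᶜ.Adj v2 c := by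
      by_contra! hbad
      obtain ⟨b, hb⟩ := Finset.card_pos.1 (show 0 < B.card by omega)
      have hsub : A.erase v1 ⊆ A ∩ G.neighborFinset b := by
        intro x hx
        obtain ⟨hx1, hx2⟩ := Finset.mem_erase.1 hx
        have := hbad x hx2 hx1 b hb
        have hne : x ≠ b := fun h => hAB x hx2 (h ▸ hb)
        rw [G.compl_adj] at this
        simp only [Finset.mem_inter, SimpleGraph.mem_neighborFinset]
        refine ⟨hx2, ?_⟩
        by_contra h
        exact this ⟨hne, fun h' => h h'.symm⟩
      have h2 := Finset.card_le_card hsub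
      have h3 := Finset.pred_card_le_card_erase (s := A) (a := v1)
      have := hdBA b hb
      omega
    obtain ⟨v2, h2, h12, c, hc, hc2⟩ := e2
    have : 1 < ((B ∩ Gᶜ.neighborFinset v1).erase c).card := by
      have h1 := Finset.pred_card_le_card_erase (s := B ∩ Gᶜ.neighborFinset v1) (a := c)
      omega
    obtain ⟨a, ha, b, hb, hab⟩ := Finset.one_lt_card.1 this
    simp only [Finset.mem_erase, Finset.mem_inter, SimpleGraph.mem_neighborFinset] at ha hb
    refine contains_treeDD Gᶜ n (by omega) v v1 v2 a b c (A \ {v1, v2})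
      ((memA _).1 h1) ((memA _).1 h2) ha.2.2 hb.2.2 hc2 ?_ ?_ ?_ ?_
    · have hne : ∀ x ∈ A, ∀ y ∈ B, x ≠ y := fun x hx y hy h => hAB x hx (h ▸ hy)
      have hnv : ∀ x ∈ A, v ≠ x := fun x hx h => hvA (h ▸ hx)
      have hnb : ∀ x ∈ B, v ≠ x := fun x hx h => hvB (h ▸ hx)
      simp only [List.nodup_cons, List.mem_cons, List.not_mem_nil, or_false, not_or]
      exact ⟨⟨hnv _ h1, hnv _ h2, hnb _ ha.2.1, hnb _ hb.2.1, hnb _ hc⟩,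
        ⟨h12.symm, hne _ h1 _ ha.2.1, hne _ h1 _ hb.2.1, hne _ h1 _ hc⟩,
        ⟨hne _ h2 _ ha.2.1, hne _ h2 _ hb.2.1, hne _ h2 _ hc⟩,
        ⟨hab, ha.1⟩, hb.1, by simp, List.nodup_nil⟩
    · have h3 := Finset.le_card_sdiff {v1, v2} A
      have h4 : ({v1, v2} : Finset V).card ≤ 2 := Finset.card_le_two
      omega
    · intro x hx; exact (memA _).1 (Finset.mem_sdiff.1 hx).1
    · intro x hx
      simp only [Finset.mem_sdiff, Finset.mem_insert, Finset.mem_singleton, not_or] at hx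
      simp only [List.mem_cons, List.not_mem_nil, or_false, not_or]
      grind

end upper

section lower
open scoped Classical

theorem le_degree {V : Type*} [Fintype V] (G : SimpleGraph V) (x : V) (k : ℕ) (g : Fin k → V)
    (hg : Function.Injective g) (h : ∀ i, G.Adj x (g i)) : k ≤ G.degree x := by
  rw [← G.card_neighborFinset_eq_degree]
  have : (Finset.univ.image g).card = k := by
    rw [Finset.card_image_of_injective _ hg]; simp
  rw [← this]
  apply Finset.card_le_card
  intro y hy
  simp at hy
  obtain ⟨i, rfl⟩ := hy
  simpa using h i

theorem degree_of_doubleStar {V : Type*} [Fintype V] (G : SimpleGraph V) (k : ℕ)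
    (f : Fin (k + 1 + 2) ↪ V) (hf : ∀ a b, (doubleStar k 1).Adj a b → G.Adj (f a) (f b)) :
    k + 1 ≤ G.degree (f 0) := by
  apply le_degree G _ _ (fun i : Fin (k + 1) => f ⟨i + 1, by omega⟩)
  · intro i j h
    have := f.injective h
    simp at this
    exact Fin.ext this
  · intro i
    apply hf
    rw [doubleStar, SimpleGraph.fromRel_adj]
    have hz : ((0 : Fin (k + 1 + 2)) : ℕ) = 0 := rfl
    have hi := i.2
    refine ⟨fun h => ?_, Or.inl ?_⟩
    · have h' := congrArg Fin.val h
      rw [hz] at h'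
      exact absurd h'.symm (Nat.succ_ne_zero _)
    · rw [hz]
      change _ ∨ (0 = 0 ∧ 2 ≤ (i : ℕ) + 1 ∧ (i : ℕ) + 1 ≤ k + 1) ∨ _
      change (0 = 0 ∧ (i : ℕ) + 1 = 1) ∨ _
      have hi := i.2
      rcases Nat.eq_zero_or_pos (i : ℕ) with h | h
      · left; omega
      · right; left; omega

theorem degree_of_treeDD {V : Type*} [Fintype V] (G : SimpleGraph V) (n : ℕ) (hn : 6 ≤ n)
    (h : Contains G (treeDD n)) : ∃ x, n - 4 ≤ G.degree x := by
  obtain ⟨f, hf⟩ := h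
  refine ⟨f ⟨0, by omega⟩, ?_⟩
  apply le_degree G _ _ (fun i : Fin (n - 4) => f ⟨i + 1, by omega⟩)
  · intro i j h
    have := f.injective h
    simp at this
    exact Fin.ext this
  · intro i
    apply hf
    rw [treeDD, SimpleGraph.fromRel_adj]
    refine ⟨by simp [Fin.ext_iff], Or.inl ?_⟩
    simp

theorem exists_even_regular (N e : ℕ) (h : 2 * e < N) :
    ∃ G : SimpleGraph (Fin N), ∀ v, G.degree v = 2 * e := by
  obtain ⟨M, rfl⟩ : ∃ M, N = M + 1 := ⟨N - 1, by omega⟩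
  let S : Finset (Fin (M + 1)) := Finset.univ.filter fun x =>
    (1 ≤ x.val ∧ x.val ≤ e) ∨ M + 1 - e ≤ x.val
  have hneg : ∀ x ∈ S, -x ∈ S := by
    intro x hx
    have hx2 := x.2
    simp only [S, Finset.mem_filter, Finset.mem_univ, true_and] at hx ⊢
    have : x.val ≠ 0 := by omega
    rw [Fin.val_neg', Nat.mod_eq_of_lt (by omega)]
    omega
  have h0 : (0 : Fin (M + 1)) ∉ S := by
    simp [S]; omega
  have hS : S.card = 2 * e := by
    have : S.map Fin.valEmbedding = Finset.Icc 1 e ∪ Finset.Icc (M + 1 - e) M := by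
      ext x
      simp only [S, Finset.mem_map, Finset.mem_filter, Finset.mem_univ, true_and,
        Fin.valEmbedding_apply, Finset.mem_union, Finset.mem_Icc]
      constructor
      · rintro ⟨a, ha, rfl⟩
        omega
      · intro hx
        exact ⟨⟨x, by omega⟩, by simp; omega, rfl⟩
    rw [← Finset.card_map Fin.valEmbedding, this, Finset.card_union_of_disjoint]
    · simp; omega
    · rw [Finset.disjoint_left]; intro x; simp; omega
  let G : SimpleGraph (Fin (M + 1)) :=
    { Adj := fun x y => y - x ∈ S
      symm := by
        constructor
        intro x y hxy
        have := hneg _ hxy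
        rwa [neg_sub] at this
      loopless := by
        constructor
        intro x hx
        rw [sub_self] at hx
        exact h0 hx }
  refine ⟨G, fun v => ?_⟩
  rw [← G.card_neighborFinset_eq_degree, ← hS]
  rw [← Finset.card_image_of_injective S (add_left_injective v)]
  refine congrArg Finset.card (Finset.ext fun y => ?_)
  simp only [SimpleGraph.mem_neighborFinset, Finset.mem_image]
  constructor
  · intro hy
    exact ⟨y - v, hy, by simp⟩
  · rintro ⟨s, hs, rfl⟩
    change s + v - v ∈ S
    simpa using hs

theorem exists_regular (N d : ℕ) (h : d < N) (he : Even (d * N)) :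
    ∃ G : SimpleGraph (Fin N), ∀ v, G.degree v = d := by
  rcases Nat.even_or_odd d with ⟨e, rfl⟩ | hd
  · obtain ⟨G, hG⟩ := exists_even_regular N e (by omega)
    exact ⟨G, fun v => by rw [hG]; omega⟩
  · have hN : Even N := by
      rcases Nat.even_mul.1 he with h | h
      · exact absurd h (Nat.not_even_iff_odd.2 hd)
      · exact h
    obtain ⟨a, rfl⟩ := hd
    obtain ⟨b, rfl⟩ := hN
    obtain ⟨G, hG⟩ := exists_even_regular (b + b) (b - 1 - a) (by omega)
    refine ⟨Gᶜ, fun v => ?_⟩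
    have := G.degree_compl v
    rw [hG] at this
    simp only [Fintype.card_fin] at this
    have h2 : b + b - 1 - 2 * (b - 1 - a) = 2 * a + 1 := by omega
    convert this.trans h2

theorem lower_aux (m n : ℕ) (hm : 9 ≤ m) (hn : m + 5 ≤ n) :
    ∃ (V : Type) (_ : Fintype V) (G : SimpleGraph V), Fintype.card V = m + n - 7 ∧
      ¬ Contains G (doubleStar (m - 3) 1) ∧ ¬ Contains Gᶜ (treeDD n) := by
  by_cases he : Even ((m - 3) * (m + n - 7))
  · obtain ⟨G, hG⟩ := exists_regular (m + n - 7) (m - 3) (by omega) he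
    refine ⟨_, inferInstance, G, by simp, ?_, ?_⟩
    · rintro ⟨f, hf⟩
      have := degree_of_doubleStar G _ f hf
      rw [hG] at this
      omega
    · intro h
      obtain ⟨x, hx⟩ := degree_of_treeDD Gᶜ n (by omega) h
      rw [G.degree_compl, hG, Fintype.card_fin] at hx
      omega
  · have hne : Even (n - 6) := by
      rw [Nat.not_even_iff_odd, Nat.odd_mul, Nat.odd_iff, Nat.odd_iff] at he
      rw [Nat.even_iff]
      omega
    obtain ⟨H, hH⟩ := exists_regular (n - 6) (m - 3) (by omega) (hne.mul_left _)
    obtain ⟨G, hGd⟩ : ∃ G : SimpleGraph (Fin (m - 1) ⊕ Fin (n - 6)),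
      G = (⊤ : SimpleGraph (Fin (m - 1))) ⊕g H := ⟨_, rfl⟩
    have hdr : ∀ v, G.degree (Sum.inr v) = m - 3 := by
      intro v
      rw [← hH v, ← G.card_neighborFinset_eq_degree, ← H.card_neighborFinset_eq_degree,
        ← Finset.card_map (s := H.neighborFinset v)
          (Function.Embedding.inr : _ ↪ Fin (m - 1) ⊕ Fin (n - 6))]
      refine congrArg Finset.card (Finset.ext fun x => ?_)
      cases x <;> simp [hGd]
    have hdl : ∀ v, m - 2 ≤ G.degree (Sum.inl v) := by
      intro v
      have h1 : ((⊤ : SimpleGraph (Fin (m - 1))).neighborFinset v).card = m - 2 := by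
        rw [SimpleGraph.card_neighborFinset_eq_degree, SimpleGraph.complete_graph_degree]
        simp; omega
      rw [← h1, ← G.card_neighborFinset_eq_degree, 
        ← Finset.card_map (Function.Embedding.inl (β := Fin (n - 6)))]
      apply Finset.card_le_card
      intro x
      cases x <;> simp [hGd, eq_comm]
    refine ⟨_, inferInstance, G, by simp; omega, ?_, ?_⟩
    · rintro ⟨f, hf⟩
      have hd := degree_of_doubleStar G _ f hf
      rcases h0 : f 0 with x | x
      · have hs : ∀ a b, (doubleStar (m - 3) 1).Adj a b → (∃ x, f a = Sum.inl x) →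
            ∃ y, f b = Sum.inl y := by
          intro a b hab ⟨x, hx⟩
          have := hf a b hab
          rw [hx] at this
          rcases hb : f b with y | y
          · exact ⟨y, rfl⟩
          · rw [hb] at this; simp [hGd] at this
        have h1 : ∃ y, f 1 = Sum.inl y := by
          apply hs 0 1 _ ⟨x, h0⟩
          rw [doubleStar, SimpleGraph.fromRel_adj]
          refine ⟨by simp [Fin.ext_iff], by simp⟩
        have hall : ∀ i, ∃ y, f i = Sum.inl y := by
          intro i
          by_cases hi0 : i = 0
          · exact ⟨x, hi0 ▸ h0⟩
          by_cases hi1 : i = 1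
          · rw [hi1]; exact h1
          have hi0' : i.val ≠ 0 := fun h => hi0 (Fin.ext h)
          have hi1' : i.val ≠ 1 := fun h => hi1 (Fin.ext (by simpa using h))
          by_cases hi : i.val ≤ m - 3 + 1
          · apply hs 0 i _ ⟨x, h0⟩
            rw [doubleStar, SimpleGraph.fromRel_adj]
            refine ⟨Ne.symm hi0, Or.inl (Or.inr (Or.inl ⟨by simp, by omega, hi⟩))⟩
          · apply hs 1 i _ h1
            rw [doubleStar, SimpleGraph.fromRel_adj]
            refine ⟨Ne.symm hi1, Or.inl (Or.inr (Or.inr ⟨by simp, by omega⟩))⟩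
        choose g hg using hall
        have hgi : Function.Injective g := by
          intro i j hij
          apply f.injective
          rw [hg, hg, hij]
        have := Fintype.card_le_of_injective g hgi
        simp at this
        omega
      · rw [h0, hdr] at hd
        omega
    · intro h
      obtain ⟨x, hx⟩ := degree_of_treeDD Gᶜ n (by omega) h
      rw [G.degree_compl, Fintype.card_sum, Fintype.card_fin, Fintype.card_fin] at hx
      rcases x with x | x
      · have := hdl x
        omega
      · rw [hdr] at hx
        omega

theorem lower (m n p : ℕ) (hm : 9 ≤ m) (hn : m + 5 ≤ n) (hp : p < m + n - 6) :
    ∃ G : SimpleGraph (Fin p), ¬ Contains G (doubleStar (m - 3) 1) ∧ ¬ Contains Gᶜ (treeDD n) := by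
  obtain ⟨V, _, G, hV, h1, h2⟩ := lower_aux m n hm hn
  obtain ⟨e⟩ : Nonempty (Fin p ↪ V) := by
    apply Function.Embedding.nonempty_of_card_le
    simp; omega
  refine ⟨G.comap e, ?_, ?_⟩
  · rintro ⟨f, hf⟩
    exact h1 ⟨f.trans e, fun a b hab => hf a b hab⟩
  · rintro ⟨f, hf⟩
    refine h2 ⟨f.trans e, fun a b hab => ?_⟩
    have := hf a b hab
    rw [SimpleGraph.compl_adj] at this ⊢
    exact ⟨fun h => this.1 (e.injective h), this.2⟩

end lower

theorem stmt17 (m n : ℕ) (hm : 9 ≤ m)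
    (hn : (n : ℝ) > (m : ℝ) + 1 + max 3 (11 / ((m : ℝ) - 8)))
    (hndvd : ¬ (m - 1) ∣ (n - 5)) :
    ramseyNumber (doubleStar (m - 3) 1) (treeDD n) = m + n - 6 := by
  have hn5 : m + 5 ≤ n := by
    have h := le_max_left (3 : ℝ) (11 / ((m : ℝ) - 8))
    have h' : (m : ℝ) + 4 < n := by linarith
    have : m + 4 < n := by exact_mod_cast h'
    omega
  have hn9 : m = 9 → 15 ≤ n := by
    rintro rfl
    have h := le_max_right (3 : ℝ) (11 / (((9 : ℕ) : ℝ) - 8))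
    have h3 : (11 : ℝ) / (((9 : ℕ) : ℝ) - 8) = 11 := by norm_num
    rw [h3] at h hn
    have h' : (14 : ℝ) < n := by
      push_cast at hn
      linarith
    have : 14 < n := by exact_mod_cast h'
    omega
  have hmem : m + n - 6 ∈ {p | 0 < p ∧ ∀ G : SimpleGraph (Fin p),
      Contains G (doubleStar (m - 3) 1) ∨ Contains Gᶜ (treeDD n)} := by
    refine ⟨by omega, fun G => ?_⟩
    by_cases h : Contains G (doubleStar (m - 3) 1)
    · exact Or.inl h
    · exact Or.inr (upper G m n hm hn5 hn9 h (by simp) hndvd)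
  apply le_antisymm
  · exact Nat.sInf_le hmem
  · apply le_csInf ⟨_, hmem⟩
    rintro p ⟨-, hp⟩
    by_contra hlt
    obtain ⟨G, h1, h2⟩ := lower m n p hm hn5 (by omega)
    rcases hp G with h | h
    · exact h1 h
    · exact h2 h
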